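/- As n → ∞, 𝔼(y_{n+1}^2 Π̂(n)) = n/M_n^3 + O(n/M_n^4). -/

import Mathlib

open MeasureTheory Filter Finset Asymptotics
open scoped Classical

/-- `y_m(α) = ∏_{j ∈ α, j < m} (1 - 1/j)` (empty product = 1). -/
noncomputable def hawkinsY (A : Set ℕ) (m : ℕ) : ℝ :=
  ∏ j ∈ Finset.range m, if j ∈ A then 1 - 1 / (j : ℝ) else 1

/-- The σ-algebra generated by the events `{j ∈ α}` for `2 ≤ j < m`. -/
def sieveSigma {Ω : Type*} (α : Ω → Set ℕ) (m : ℕ) : MeasurableSpace Ω :=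
  MeasurableSpace.generateFrom {s | ∃ j : ℕ, 2 ≤ j ∧ j < m ∧ s = {ω | j ∈ α ω}}

/-- Wunderlich's model of the Hawkins random sieve: a probability space `(Ω, μ)` with a
random subset `α` of `{2,3,4,…}` such that `μ(2 ∈ α) = 1` and, for every `m ≥ 2`, the
conditional probability of `{m ∈ α}` given the σ-algebra generated by the events
`{j ∈ α}`, `2 ≤ j < m`, equals `y_m(α)`. -/
structure IsHawkinsSieve {Ω : Type*} [MeasurableSpace Ω] (μ : Measure Ω)
    (α : Ω → Set ℕ) : Prop where
  isProb : IsProbabilityMeasure μ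
  meas : ∀ n : ℕ, MeasurableSet {ω | n ∈ α ω}
  mem_ge_two : ∀ ω, ∀ n ∈ α ω, 2 ≤ n
  two_mem : μ {ω | 2 ∈ α ω} = 1
  condExp_mem : ∀ m : ℕ, 2 ≤ m →
    μ[Set.indicator {ω | m ∈ α ω} (fun _ => (1 : ℝ)) | sieveSigma α m]
      =ᵐ[μ] fun ω => hawkinsY (α ω) m

/-- `M_k = 1 + ∑_{j=1}^{k-2} 1/j` (so `M_2 = 1`). -/
noncomputable def Mharm (k : ℕ) : ℝ := 1 + ∑ j ∈ Finset.Icc 1 (k - 2), 1 / (j : ℝ)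

/-- `Π̂(x; α) = Σ_{m ≤ x, m ∈ α, m+2 ∈ α} (y_m(α) - (1/(m+1))(1 - 1/m) y_m(α)^2)⁻¹`. -/
noncomputable def piHat (A : Set ℕ) (x : ℕ) : ℝ :=
  ∑ m ∈ Finset.range (x + 1),
    if m ∈ A ∧ m + 2 ∈ A then
      (hawkinsY A m - (1 / ((m : ℝ) + 1)) * (1 - 1 / (m : ℝ)) * (hawkinsY A m) ^ 2)⁻¹
    else 0

/-- `F A` only depends on `A ∩ [0, m)`. -/
def DependsBelow (m : ℕ) (F : Set ℕ → ℝ) : Prop :=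
  ∀ A B : Set ℕ, (∀ j < m, j ∈ A ↔ j ∈ B) → F A = F B

namespace DependsBelow

variable {m n : ℕ} {F G : Set ℕ → ℝ}

lemma mono (hF : DependsBelow m F) (hmn : m ≤ n) : DependsBelow n F :=
  fun A B hAB => hF A B fun j hj => hAB j (hj.trans_le hmn)

lemma const (m : ℕ) (c : ℝ) : DependsBelow m fun _ => c := fun _ _ _ => rfl

lemma mul (hF : DependsBelow m F) (hG : DependsBelow m G) :
    DependsBelow m fun A => F A * G A := fun A B hAB => by
  simp only [hF A B hAB, hG A B hAB]

lemma comp (hF : DependsBelow m F) (g : ℝ → ℝ) : DependsBelow m fun A => g (F A) :=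
  fun A B hAB => by simp only [hF A B hAB]

lemma pow (hF : DependsBelow m F) (k : ℕ) : DependsBelow m fun A => F A ^ k :=
  hF.comp (· ^ k)

lemma inv (hF : DependsBelow m F) : DependsBelow m fun A => (F A)⁻¹ := hF.comp (·⁻¹)

lemma mem (hmn : m < n) : DependsBelow n fun A => if m ∈ A then (1 : ℝ) else 0 :=
  fun A B hAB => by simp only [hAB m hmn]

lemma weight (m : ℕ) : DependsBelow m fun A => hawkinsY A m := fun A B hAB => by
  refine Finset.prod_congr rfl fun j hj => ?_
  simp only [hAB j (Finset.mem_range.1 hj)]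

lemma exists_factorization (hF : DependsBelow m F) :
    ∃ g : (Fin m → Prop) → ℝ, ∀ A, F A = g fun j => (j : ℕ) ∈ A :=
  ⟨fun p => F {j | ∃ hj : j < m, p ⟨j, hj⟩}, fun A => hF _ _ fun j hj => by simp [hj]⟩

lemma measurable_sieveSigma {Ω : Type*} {α : Ω → Set ℕ} (hF : DependsBelow m F)
    (hα : ∀ ω, ∀ n ∈ α ω, 2 ≤ n) : Measurable[sieveSigma α m] fun ω => F (α ω) := by
  obtain ⟨g, hg⟩ := hF.exists_factorization
  simp only [hg]
  let _ : MeasurableSpace Ω := sieveSigma α m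
  refine (measurable_of_finite g).comp (measurable_pi_iff.2 fun j => ?_)
  refine measurableSet_setOfPred.1 ?_
  by_cases hj : 2 ≤ (j : ℕ)
  · exact MeasurableSpace.measurableSet_generateFrom ⟨j, hj, j.2, rfl⟩
  · convert MeasurableSet.empty
    ext ω
    simpa using fun hω => hj (hα ω j hω)

lemma exists_bound (hF : DependsBelow m F) : ∃ C, ∀ A, ‖F A‖ ≤ C := by
  obtain ⟨g, hg⟩ := hF.exists_factorization
  obtain ⟨C, hC⟩ := (Set.finite_range fun p => ‖g p‖).bddAbove
  exact ⟨C, fun A => by rw [hg]; exact hC ⟨_, rfl⟩⟩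

end DependsBelow

lemma sieveSigma_le {Ω : Type*} [mΩ : MeasurableSpace Ω] {α : Ω → Set ℕ}
    (hα : ∀ n : ℕ, MeasurableSet {ω | n ∈ α ω}) (m : ℕ) : sieveSigma α m ≤ mΩ := by
  refine MeasurableSpace.generateFrom_le ?_
  rintro s ⟨j, -, -, rfl⟩
  exact hα j

namespace IsHawkinsSieve

variable {Ω : Type*} [MeasurableSpace Ω] {μ : Measure Ω} {α : Ω → Set ℕ} {m : ℕ}
  {F G : Set ℕ → ℝ}

lemma integrable (h : IsHawkinsSieve μ α) (hF : DependsBelow m F) :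
    Integrable (fun ω => F (α ω)) μ := by
  have := h.isProb
  obtain ⟨C, hC⟩ := hF.exists_bound
  exact Integrable.of_bound
    (((hF.measurable_sieveSigma h.mem_ge_two).mono (sieveSigma_le h.meas m)
      le_rfl).aestronglyMeasurable) C (ae_of_all _ fun ω => hC _)

lemma integral_mono (h : IsHawkinsSieve μ α) (hF : DependsBelow m F) (hG : DependsBelow m G)
    (hFG : ∀ A : Set ℕ, (∀ n ∈ A, 2 ≤ n) → F A ≤ G A) :
    ∫ ω, F (α ω) ∂μ ≤ ∫ ω, G (α ω) ∂μ :=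
  MeasureTheory.integral_mono (h.integrable hF) (h.integrable hG)
    fun ω => hFG _ (h.mem_ge_two ω)

lemma integral_mul_mem (h : IsHawkinsSieve μ α) (hm : 2 ≤ m) (hF : DependsBelow m F) :
    ∫ ω, F (α ω) * (if m ∈ α ω then 1 else 0) ∂μ = ∫ ω, F (α ω) * hawkinsY (α ω) m ∂μ := by
  have := h.isProb
  have hle := sieveSigma_le h.meas m
  have hind : Set.indicator {ω | m ∈ α ω} (fun _ => (1 : ℝ)) =
      fun ω => if m ∈ α ω then 1 else 0 := by
    ext ω
    simp [Set.indicator_apply]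
  have hce := h.condExp_mem m hm
  rw [hind] at hce
  have hint : Integrable (fun ω => F (α ω) * (if m ∈ α ω then (1 : ℝ) else 0)) μ :=
    h.integrable (m := m + 1) ((hF.mono m.le_succ).mul (DependsBelow.mem m.lt_succ_self))
  rw [← integral_condExp hle]
  refine integral_congr_ae ?_
  have hpull := condExp_mul_of_stronglyMeasurable_left (μ := μ)
    (hF.measurable_sieveSigma h.mem_ge_two).stronglyMeasurable hint
    (h.integrable (m := m + 1) (DependsBelow.mem m.lt_succ_self))
  refine hpull.trans ?_
  filter_upwards [hce] with ω hω
  simp only [Pi.mul_apply, hω]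

end IsHawkinsSieve

section Weight

variable {A : Set ℕ} {j m n k : ℕ}

lemma hawkinsY_succ (A : Set ℕ) (m : ℕ) :
    hawkinsY A (m + 1) = hawkinsY A m * if m ∈ A then 1 - 1 / (m : ℝ) else 1 :=
  Finset.prod_range_succ _ _

lemma hawkinsY_factor_mem_Ioc (hA : ∀ n ∈ A, 2 ≤ n) (j : ℕ) :
    (if j ∈ A then 1 - 1 / (j : ℝ) else 1) ∈ Set.Ioc (0 : ℝ) 1 := by
  split_ifs with hj
  · have h2 : (2 : ℝ) ≤ j := by exact_mod_cast hA j hj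
    have : 1 / (j : ℝ) ≤ 1 / 2 := one_div_le_one_div_of_le (by norm_num) h2
    have : 0 < 1 / (j : ℝ) := by positivity
    constructor <;> linarith
  · simp

lemma hawkinsY_pos (hA : ∀ n ∈ A, 2 ≤ n) (m : ℕ) : 0 < hawkinsY A m :=
  Finset.prod_pos fun j _ => (hawkinsY_factor_mem_Ioc hA j).1

lemma hawkinsY_le_one (hA : ∀ n ∈ A, 2 ≤ n) (m : ℕ) : hawkinsY A m ≤ 1 :=
  Finset.prod_le_one (fun j _ => (hawkinsY_factor_mem_Ioc hA j).1.le)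
    fun j _ => (hawkinsY_factor_mem_Ioc hA j).2

lemma hawkinsY_antitone (hA : ∀ n ∈ A, 2 ≤ n) : Antitone (hawkinsY A) :=
  antitone_nat_of_succ_le fun m => by
    rw [hawkinsY_succ]
    exact mul_le_of_le_one_right (hawkinsY_pos hA m).le (hawkinsY_factor_mem_Ioc hA m).2

lemma hawkinsY_two (hA : ∀ n ∈ A, 2 ≤ n) : hawkinsY A 2 = 1 := by
  refine Finset.prod_eq_one fun j hj => if_neg fun hjA => ?_
  have := hA j hjA
  have := Finset.mem_range.1 hj
  omega

lemma hawkinsY_succ_pow (A : Set ℕ) (j k : ℕ) :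
    hawkinsY A (j + 1) ^ k = hawkinsY A j ^ k -
      (1 - (1 - 1 / (j : ℝ)) ^ k) * (hawkinsY A j ^ k * if j ∈ A then 1 else 0) := by
  rw [hawkinsY_succ, mul_pow]
  split_ifs <;> ring

lemma inv_hawkinsY_succ (A : Set ℕ) (hj : 2 ≤ j) :
    (hawkinsY A (j + 1))⁻¹ = (hawkinsY A j)⁻¹ +
      1 / ((j : ℝ) - 1) * ((hawkinsY A j)⁻¹ * if j ∈ A then 1 else 0) := by
  have h2 : (2 : ℝ) ≤ j := by exact_mod_cast hj
  have h1 : (j : ℝ) - 1 ≠ 0 := by linarith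
  have h0 : (j : ℝ) ≠ 0 := by linarith
  rw [hawkinsY_succ, mul_inv]
  split_ifs
  · rw [one_sub_div h0]
    field_simp
    ring
  · simp

lemma inv_hawkinsY_succ_le (hA : ∀ n ∈ A, 2 ≤ n) (hj : 2 ≤ j) :
    (hawkinsY A (j + 1))⁻¹ ≤ (j : ℝ) / (j - 1) * (hawkinsY A j)⁻¹ := by
  have h2 : (2 : ℝ) ≤ j := by exact_mod_cast hj
  have h1 : 0 < (j : ℝ) - 1 := by linarith
  have hY : 0 < (hawkinsY A j)⁻¹ := inv_pos.2 (hawkinsY_pos hA j)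
  have e : (j : ℝ) / (j - 1) = 1 + 1 / (j - 1) := by field_simp; ring
  rw [inv_hawkinsY_succ A hj, e, add_mul, one_mul]
  gcongr
  split_ifs <;> linarith

/-- The summand of `piHat`. -/
noncomputable def twinWeight (m : ℕ) (A : Set ℕ) : ℝ :=
  if m ∈ A ∧ m + 2 ∈ A then
    (hawkinsY A m - (1 / ((m : ℝ) + 1)) * (1 - 1 / (m : ℝ)) * (hawkinsY A m) ^ 2)⁻¹
  else 0

lemma twinWeight_den_pos (hA : ∀ n ∈ A, 2 ≤ n) (hm : 2 ≤ m) :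
    0 < hawkinsY A m - (1 / ((m : ℝ) + 1)) * (1 - 1 / (m : ℝ)) * (hawkinsY A m) ^ 2 := by
  have h2 : (2 : ℝ) ≤ m := by exact_mod_cast hm
  have hY := hawkinsY_pos hA m
  have hY1 := hawkinsY_le_one hA m
  have e1 : 1 / ((m : ℝ) + 1) ≤ 1 / 2 := one_div_le_one_div_of_le (by norm_num) (by linarith)
  have e1' : 0 ≤ 1 / ((m : ℝ) + 1) := by positivity
  have e2 : 0 < 1 / (m : ℝ) := by positivity
  have e3 : 1 / (m : ℝ) ≤ 1 / 2 := one_div_le_one_div_of_le (by norm_num) (by linarith)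
  have e4 : 1 / ((m : ℝ) + 1) * (1 - 1 / (m : ℝ)) ≤ 1 / 2 * 1 :=
    mul_le_mul e1 (by linarith) (by linarith) (by norm_num)
  have e5 : hawkinsY A m ^ 2 ≤ hawkinsY A m := by nlinarith
  nlinarith [mul_nonneg e1' (by linarith : 0 ≤ 1 - 1 / (m : ℝ)), sq_nonneg (hawkinsY A m)]

lemma twinWeight_nonneg (hA : ∀ n ∈ A, 2 ≤ n) (m : ℕ) : 0 ≤ twinWeight m A := by
  unfold twinWeight
  split_ifs with hmA
  · exact (inv_pos.2 (twinWeight_den_pos hA (hA m hmA.1))).le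
  · exact le_rfl

lemma piHat_eq_sum_Icc (hA : ∀ n ∈ A, 2 ≤ n) (n : ℕ) :
    piHat A n = ∑ m ∈ Finset.Icc 2 n, twinWeight m A := by
  refine (Finset.sum_subset (fun m hm => ?_) fun m hm hm' => if_neg fun hmA => hm' ?_).symm
  · simp only [Finset.mem_Icc, Finset.mem_range] at *
    omega
  · have := hA m hmA.1
    simp only [Finset.mem_Icc, Finset.mem_range] at *
    omega

lemma DependsBelow.twinWeight (m : ℕ) : DependsBelow (m + 3) (twinWeight m) := by
  intro A B hAB
  have hY := DependsBelow.weight m A B fun j hj => hAB j (by omega)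
  simp only [_root_.twinWeight, hY, hAB m (by omega), hAB (m + 2) (by omega)]

end Weight

namespace IsHawkinsSieve

variable {Ω : Type*} [MeasurableSpace Ω] {μ : Measure Ω} {α : Ω → Set ℕ} {j m n : ℕ}
  {F : Set ℕ → ℝ}

lemma integral_mul_pow_succ (h : IsHawkinsSieve μ α) (hj : 2 ≤ j) (hF : DependsBelow j F)
    (k : ℕ) :
    ∫ ω, F (α ω) * hawkinsY (α ω) (j + 1) ^ k ∂μ =
      ∫ ω, F (α ω) * hawkinsY (α ω) j ^ k ∂μ -
        (1 - (1 - 1 / (j : ℝ)) ^ k) * ∫ ω, F (α ω) * hawkinsY (α ω) j ^ (k + 1) ∂μ := by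
  have hFY := hF.mul ((DependsBelow.weight j).pow k)
  have key := h.integral_mul_mem hj hFY
  simp only [mul_assoc, ← pow_succ] at key
  rw [← key, ← integral_const_mul, ← integral_sub (h.integrable hFY)]
  · simp only [hawkinsY_succ_pow _ j k]
    congr 1
    ext ω
    ring
  · have := (h.integrable ((hFY.mono j.le_succ).mul (DependsBelow.mem j.lt_succ_self))).const_mul
      (1 - (1 - 1 / (j : ℝ)) ^ k)
    simpa only [mul_assoc] using this

lemma integral_mul_inv_succ (h : IsHawkinsSieve μ α) (hj : 2 ≤ j) (hF : DependsBelow j F) :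
    ∫ ω, F (α ω) * (hawkinsY (α ω) (j + 1))⁻¹ ∂μ =
      ∫ ω, F (α ω) * (hawkinsY (α ω) j)⁻¹ ∂μ + 1 / ((j : ℝ) - 1) * ∫ ω, F (α ω) ∂μ := by
  have hFY := hF.mul (DependsBelow.weight j).inv
  have key := h.integral_mul_mem hj hFY
  have hc : ∀ ω, F (α ω) * (hawkinsY (α ω) j)⁻¹ * hawkinsY (α ω) j = F (α ω) := fun ω =>
    inv_mul_cancel_right₀ (hawkinsY_pos (h.mem_ge_two ω) j).ne' _
  simp only [hc] at key
  rw [← key, ← integral_const_mul, ← integral_add (h.integrable hFY)]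
  · simp only [inv_hawkinsY_succ _ hj]
    congr 1
    ext ω
    ring
  · exact (h.integrable ((hFY.mono j.le_succ).mul (DependsBelow.mem j.lt_succ_self))).const_mul _

lemma integral_mul_twinWeight (h : IsHawkinsSieve μ α) (hm : 2 ≤ m) (hF : DependsBelow m F) :
    ∫ ω, F (α ω) * twinWeight m (α ω) ∂μ =
      (1 - 1 / (m : ℝ)) * ∫ ω, F (α ω) * hawkinsY (α ω) m ∂μ := by
  set c : ℝ := 1 - 1 / (m : ℝ) with hc
  have hY := DependsBelow.weight m
  set D : Set ℕ → ℝ := fun A =>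
    (hawkinsY A m - (1 / ((m : ℝ) + 1)) * c * (hawkinsY A m) ^ 2)⁻¹ with hD
  have hDm : DependsBelow m D :=
    hY.comp fun y => (y - (1 / ((m : ℝ) + 1)) * c * y ^ 2)⁻¹
  set G : Set ℕ → ℝ := fun A => F A * D A * (if m ∈ A then 1 else 0) with hG
  have hGm : DependsBelow (m + 1) G :=
    ((hF.mul hDm).mono m.le_succ).mul (DependsBelow.mem m.lt_succ_self)
  have step1 : ∫ ω, F (α ω) * twinWeight m (α ω) ∂μ =
      ∫ ω, G (α ω) * hawkinsY (α ω) (m + 2) ^ 1 ∂μ := by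
    simp only [pow_one]
    rw [← h.integral_mul_mem (by omega : 2 ≤ m + 2) (hGm.mono (by omega))]
    refine integral_congr_ae (ae_of_all _ fun ω => ?_)
    simp only [twinWeight, ← hc, hG, hD]
    by_cases h1 : m ∈ α ω <;> by_cases h2 : m + 2 ∈ α ω <;> simp [h1, h2]
  have hcast : ((m + 1 : ℕ) : ℝ) = (m : ℝ) + 1 := by push_cast; ring
  have hGY : DependsBelow (m + 1) fun A => G A * hawkinsY A (m + 1) ^ 1 :=
    hGm.mul ((DependsBelow.weight (m + 1)).pow 1)
  have hGY2 : DependsBelow (m + 1) fun A => G A * hawkinsY A (m + 1) ^ 2 :=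
    hGm.mul ((DependsBelow.weight (m + 1)).pow 2)
  rw [step1, h.integral_mul_pow_succ (by omega : 2 ≤ m + 1) hGm 1, hcast,
    ← integral_const_mul, ← integral_sub (h.integrable hGY) ((h.integrable hGY2).const_mul _)]
  have hH : DependsBelow m fun A =>
      F A * D A * (c * hawkinsY A m - 1 / ((m : ℝ) + 1) * (c * hawkinsY A m) ^ 2) :=
    (hF.mul hDm).mul (hY.comp fun y => c * y - 1 / ((m : ℝ) + 1) * (c * y) ^ 2)
  rw [← integral_const_mul]
  calc
    _ = ∫ ω, F (α ω) * D (α ω) *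
          (c * hawkinsY (α ω) m - 1 / ((m : ℝ) + 1) * (c * hawkinsY (α ω) m) ^ 2) *
          (if m ∈ α ω then 1 else 0) ∂μ := by
      refine integral_congr_ae (ae_of_all _ fun ω => ?_)
      simp only [hG, hawkinsY_succ]
      split_ifs
      · rw [← hc]
        ring
      · ring
    _ = _ := by
      rw [h.integral_mul_mem hm hH]
      refine integral_congr_ae (ae_of_all _ fun ω => ?_)
      have hpos := (twinWeight_den_pos (h.mem_ge_two ω) hm).ne'
      rw [← hc] at hpos
      simp only [hD]
      have e : c * hawkinsY (α ω) m - 1 / ((m : ℝ) + 1) * (c * hawkinsY (α ω) m) ^ 2 =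
          c * (hawkinsY (α ω) m - 1 / ((m : ℝ) + 1) * c * hawkinsY (α ω) m ^ 2) := by ring
      rw [e]
      generalize hawkinsY (α ω) m - 1 / ((m : ℝ) + 1) * c * hawkinsY (α ω) m ^ 2 = d at hpos
      field_simp

end IsHawkinsSieve

section Mharm

variable {j m n : ℕ}

lemma Mharm_two : Mharm 2 = 1 := by simp [Mharm]

lemma Mharm_succ (hj : 2 ≤ j) : Mharm (j + 1) = Mharm j + 1 / ((j : ℝ) - 1) := by
  obtain ⟨i, rfl⟩ := Nat.exists_eq_add_of_le' hj
  simp only [Mharm, show i + 2 + 1 - 2 = i + 1 by omega, show i + 2 - 2 = i by omega,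
    Finset.sum_Icc_succ_top (show 1 ≤ i + 1 by omega)]
  push_cast
  ring

lemma Mharm_mono : Monotone Mharm := by
  intro m n hmn
  unfold Mharm
  gcongr

lemma one_le_Mharm (m : ℕ) : 1 ≤ Mharm m := by
  unfold Mharm
  have : 0 ≤ ∑ j ∈ Finset.Icc 1 (m - 2), 1 / (j : ℝ) := Finset.sum_nonneg fun _ _ => by positivity
  linarith

/-- A minorant of `Mharm` up to a bounded error, with increments `(j - 2) / (j (j - 1))`. -/
noncomputable def MharmLower (j : ℕ) : ℝ := Mharm j - 2 + 2 / ((j : ℝ) - 1)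

lemma MharmLower_two : MharmLower 2 = 1 := by
  norm_num [MharmLower, Mharm_two]

lemma MharmLower_succ (hj : 2 ≤ j) :
    MharmLower (j + 1) = MharmLower j + ((j : ℝ) - 2) / (j * (j - 1)) := by
  have h2 : (2 : ℝ) ≤ j := by exact_mod_cast hj
  have h1 : (j : ℝ) - 1 ≠ 0 := by linarith
  have h0 : (j : ℝ) ≠ 0 := by linarith
  simp only [MharmLower, Mharm_succ hj]
  push_cast
  rw [add_sub_cancel_right]
  field_simp
  ring

lemma MharmLower_increment_nonneg (hj : 2 ≤ j) : 0 ≤ ((j : ℝ) - 2) / (j * (j - 1)) := by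
  have h2 : (2 : ℝ) ≤ j := by exact_mod_cast hj
  exact div_nonneg (by linarith) (mul_nonneg (by linarith) (by linarith))

lemma MharmLower_increment_le_sixth (hj : 2 ≤ j) : ((j : ℝ) - 2) / (j * (j - 1)) ≤ 1 / 6 := by
  have h2 : (2 : ℝ) ≤ j := by exact_mod_cast hj
  have h34 : 0 ≤ ((j : ℝ) - 3) * (j - 4) := by
    rcases Nat.lt_or_ge j 4 with hlt | hge
    · have : (j : ℝ) ≤ 3 := by exact_mod_cast Nat.lt_succ_iff.1 hlt
      exact mul_nonneg_of_nonpos_of_nonpos (by linarith) (by linarith)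
    · have : (4 : ℝ) ≤ j := by exact_mod_cast hge
      exact mul_nonneg (by linarith) (by linarith)
  rw [div_le_div_iff₀ (mul_pos (by linarith) (by linarith)) (by norm_num)]
  nlinarith

lemma MharmLower_increment_le_inv (hj : 2 ≤ j) :
    ((j : ℝ) - 2) / (j * (j - 1)) ≤ 1 / j - 1 / (j : ℝ) ^ 2 := by
  have h2 : (2 : ℝ) ≤ j := by exact_mod_cast hj
  have e : 1 / (j : ℝ) - 1 / (j : ℝ) ^ 2 = (j - 1) / j ^ 2 := by field_simp
  rw [e, div_le_div_iff₀ (mul_pos (by linarith) (by linarith)) (by positivity)]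
  nlinarith

lemma MharmLower_le_of_le (hm : 2 ≤ m) (hmn : m ≤ n) : MharmLower m ≤ MharmLower n := by
  induction n, hmn using Nat.le_induction with
  | base => exact le_rfl
  | succ n hn ih =>
    rw [MharmLower_succ (hm.trans hn)]
    linarith [MharmLower_increment_nonneg (hm.trans hn)]

lemma one_le_MharmLower (hj : 2 ≤ j) : 1 ≤ MharmLower j :=
  MharmLower_two ▸ MharmLower_le_of_le le_rfl hj

lemma Mharm_sub_two_le (hj : 2 ≤ j) : Mharm j - 2 ≤ MharmLower j := by
  have h2 : (2 : ℝ) ≤ j := by exact_mod_cast hj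
  have : 0 ≤ 2 / ((j : ℝ) - 1) := div_nonneg (by norm_num) (by linarith)
  unfold MharmLower
  linarith

end Mharm

lemma pow_tangent {k : ℕ} (hk : k = 1 ∨ k = 2 ∨ k = 3) {c y : ℝ} (hc : 0 ≤ c) (hy : 0 ≤ y) :
    (k + 1) * c * y ^ k - c ^ (k + 1) ≤ k * y ^ (k + 1) := by
  rcases hk with rfl | rfl | rfl
  · norm_num
    nlinarith [sq_nonneg (y - c)]
  · norm_num
    nlinarith [mul_nonneg (sq_nonneg (y - c)) hy, mul_nonneg (sq_nonneg (y - c)) hc]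
  · norm_num
    nlinarith [mul_nonneg (sq_nonneg (y - c)) (sq_nonneg y),
      mul_nonneg (sq_nonneg (y - c)) (sq_nonneg (y + c)),
      mul_nonneg (sq_nonneg (y - c)) (sq_nonneg c),
      mul_nonneg (sq_nonneg (y - c)) (mul_nonneg hy hc)]

lemma one_sub_mul_le_inv_pow {k : ℕ} (hk : k = 1 ∨ k = 2 ∨ k = 3) {x : ℝ} (hx : 0 ≤ x) :
    (1 - k * x) * (1 + x) ^ k ≤ 1 := by
  have := pow_nonneg hx 2
  have := pow_nonneg hx 3
  have := pow_nonneg hx 4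
  rcases hk with rfl | rfl | rfl <;> norm_num <;> nlinarith

lemma le_div_pow_step {k : ℕ} (hk : k = 1 ∨ k = 2 ∨ k = 3) {a δ W u v b u' : ℝ} (ha : 1 ≤ a)
    (hδ : 0 ≤ δ) (hδ' : δ ≤ 1 / 6) (hb : k * δ ≤ b) (hW : 0 ≤ W) (hv : 0 ≤ v)
    (hu : u ≤ W / a ^ k) (hu' : u' = u - b * v)
    (hv' : (k + 1) * a⁻¹ * u - a⁻¹ ^ (k + 1) * W ≤ k * v) : u' ≤ W / (a + δ) ^ k := by
  have ha0 : 0 < a := by linarith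
  have hc : 0 < a⁻¹ := inv_pos.2 ha0
  have hc1 : a⁻¹ ≤ 1 := inv_le_one_of_one_le₀ ha
  have hk3 : (k : ℝ) + 1 ≤ 4 := by rcases hk with rfl | rfl | rfl <;> norm_num
  have h1 : u' ≤ u - δ * ((k + 1) * a⁻¹ * u - a⁻¹ ^ (k + 1) * W) := by
    have := mul_le_mul_of_nonneg_right hb hv
    have := mul_le_mul_of_nonneg_left hv' hδ
    linarith
  have hcoef : 0 ≤ 1 - (k + 1) * (δ * a⁻¹) := by
    have : δ * a⁻¹ ≤ 1 / 6 * 1 := mul_le_mul hδ' hc1 hc.le (by norm_num)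
    have : ((k : ℝ) + 1) * (δ * a⁻¹) ≤ 4 * (1 / 6 * 1) := by
      have := mul_nonneg hδ hc.le
      gcongr
    linarith
  have hu2 : u ≤ W * a⁻¹ ^ k := by rwa [div_eq_mul_inv, ← inv_pow] at hu
  have h2 : u' ≤ W * a⁻¹ ^ k * (1 - k * (δ * a⁻¹)) := by
    have := mul_le_mul_of_nonneg_right hu2 hcoef
    have e : W * a⁻¹ ^ k * (1 - k * (δ * a⁻¹)) =
      W * a⁻¹ ^ k * (1 - (k + 1) * (δ * a⁻¹)) + δ * (a⁻¹ ^ (k + 1) * W) := by ring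
    rw [e]
    linarith
  refine h2.trans ?_
  have hx : 0 ≤ δ * a⁻¹ := mul_nonneg hδ hc.le
  have e2 : a + δ = a * (1 + δ * a⁻¹) := by field_simp
  rw [e2, mul_pow, le_div_iff₀ (by positivity)]
  have e3 : W * a⁻¹ ^ k * (1 - k * (δ * a⁻¹)) * (a ^ k * (1 + δ * a⁻¹) ^ k) =
      W * ((1 - k * (δ * a⁻¹)) * (1 + δ * a⁻¹) ^ k) := by
    have : a⁻¹ ^ k * a ^ k = 1 := by rw [← mul_pow, inv_mul_cancel₀ ha0.ne', one_pow]
    linear_combination W * (1 - k * (δ * a⁻¹)) * (1 + δ * a⁻¹) ^ k * this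
  rw [e3]
  exact mul_le_of_le_one_right hW (one_sub_mul_le_inv_pow hk hx)

lemma mul_sub_sq_le_one_sub_pow {k : ℕ} (hk : k = 1 ∨ k = 2 ∨ k = 3) {t : ℝ} (ht : 0 ≤ t) :
    k * (t - t ^ 2) ≤ 1 - (1 - t) ^ k := by
  have := pow_nonneg ht 2
  have := pow_nonneg ht 3
  rcases hk with rfl | rfl | rfl <;> norm_num <;> nlinarith

namespace IsHawkinsSieve

variable {Ω : Type*} [MeasurableSpace Ω] {μ : Measure Ω} {α : Ω → Set ℕ} {j m n : ℕ}
  {F : Set ℕ → ℝ}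

lemma integral_mul_pow_le (h : IsHawkinsSieve μ α) {k i : ℕ} (hk : k = 1 ∨ k = 2 ∨ k = 3)
    (hi : 2 ≤ i) (hF : DependsBelow i F) (hF0 : ∀ A : Set ℕ, (∀ n ∈ A, 2 ≤ n) → 0 ≤ F A)
    {s : ℝ} (hs : 1 ≤ MharmLower i - s)
    (hstart : ∫ ω, F (α ω) * hawkinsY (α ω) i ^ k ∂μ ≤
      (∫ ω, F (α ω) ∂μ) / (MharmLower i - s) ^ k) (hij : i ≤ j) :
    ∫ ω, F (α ω) * hawkinsY (α ω) j ^ k ∂μ ≤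
      (∫ ω, F (α ω) ∂μ) / (MharmLower j - s) ^ k := by
  induction j, hij using Nat.le_induction with
  | base => exact hstart
  | succ j hij ih =>
    have hj := hi.trans hij
    have hFj := hF.mono hij
    have hY := DependsBelow.weight j
    have ha : 1 ≤ MharmLower j - s := by linarith [MharmLower_le_of_le hi hij]
    rw [MharmLower_succ hj, add_sub_right_comm]
    refine le_div_pow_step hk ha (MharmLower_increment_nonneg hj)
      (MharmLower_increment_le_sixth hj) ?_ (integral_nonneg fun ω => hF0 _ (h.mem_ge_two ω))
      (integral_nonneg fun ω => mul_nonneg (hF0 _ (h.mem_ge_two ω))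
        (pow_nonneg (hawkinsY_pos (h.mem_ge_two ω) j).le _))
      ih (h.integral_mul_pow_succ hj hFj k) ?_
    · have ht : (0 : ℝ) ≤ 1 / j := by positivity
      refine le_trans ?_ (mul_sub_sq_le_one_sub_pow hk ht)
      rw [one_div_pow]
      exact mul_le_mul_of_nonneg_left (MharmLower_increment_le_inv hj) (Nat.cast_nonneg k)
    · rw [← integral_const_mul, ← integral_const_mul, ← integral_const_mul,
        ← integral_sub ((h.integrable (hFj.mul (hY.pow k))).const_mul _)
          ((h.integrable hFj).const_mul _)]
      refine MeasureTheory.integral_mono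
        (((h.integrable (hFj.mul (hY.pow k))).const_mul _).sub ((h.integrable hFj).const_mul _))
        ((h.integrable (hFj.mul (hY.pow (k + 1)))).const_mul _) fun ω => ?_
      have := mul_le_mul_of_nonneg_left (pow_tangent hk
        (inv_nonneg.2 (by linarith : 0 ≤ MharmLower j - s))
        (hawkinsY_pos (h.mem_ge_two ω) j).le) (hF0 _ (h.mem_ge_two ω))
      simp only
      linarith

lemma integral_pow_le (h : IsHawkinsSieve μ α) {k : ℕ} (hk : k = 1 ∨ k = 2 ∨ k = 3)
    (hj : 2 ≤ j) : ∫ ω, hawkinsY (α ω) j ^ k ∂μ ≤ 1 / MharmLower j ^ k := by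
  have := h.isProb
  have key := h.integral_mul_pow_le hk le_rfl (DependsBelow.const 2 1) (fun _ _ => zero_le_one)
    (s := 0) (by simp [MharmLower_two]) ?_ hj
  · simpa using key
  · simp [MharmLower_two, fun ω => hawkinsY_two (h.mem_ge_two ω)]

lemma integral_mul_inv (h : IsHawkinsSieve μ α) {i : ℕ} (hi : 2 ≤ i) (hF : DependsBelow i F)
    (hij : i ≤ j) :
    ∫ ω, F (α ω) * (hawkinsY (α ω) j)⁻¹ ∂μ =
      ∫ ω, F (α ω) * (hawkinsY (α ω) i)⁻¹ ∂μ + (Mharm j - Mharm i) * ∫ ω, F (α ω) ∂μ := by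
  induction j, hij using Nat.le_induction with
  | base => simp
  | succ j hij ih =>
    rw [h.integral_mul_inv_succ (hi.trans hij) (hF.mono hij), ih, Mharm_succ (hi.trans hij)]
    ring

lemma integral_inv (h : IsHawkinsSieve μ α) (hj : 2 ≤ j) :
    ∫ ω, (hawkinsY (α ω) j)⁻¹ ∂μ = Mharm j := by
  have := h.isProb
  have key := h.integral_mul_inv le_rfl (DependsBelow.const 2 1) hj
  simpa [fun ω => hawkinsY_two (h.mem_ge_two ω), Mharm_two] using key

lemma inv_Mharm_le_integral (h : IsHawkinsSieve μ α) (hj : 2 ≤ j) :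
    1 / Mharm j ≤ ∫ ω, hawkinsY (α ω) j ∂μ := by
  have := h.isProb
  have hM : 0 < Mharm j := zero_lt_one.trans_le (one_le_Mharm j)
  have hY := DependsBelow.weight j
  have e : 1 / Mharm j =
      ∫ ω, (2 / Mharm j - 1 / Mharm j ^ 2 * (hawkinsY (α ω) j)⁻¹) ∂μ := by
    rw [integral_sub (integrable_const _) ((h.integrable hY.inv).const_mul _), integral_const_mul,
      h.integral_inv hj]
    simp
    field_simp
    ring
  rw [e]
  refine MeasureTheory.integral_mono
    ((integrable_const _).sub ((h.integrable hY.inv).const_mul _)) (h.integrable hY) fun ω => ?_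
  have hpos := hawkinsY_pos (h.mem_ge_two ω) j
  simp only
  generalize hawkinsY (α ω) j = y at hpos
  have e : y - (2 / Mharm j - 1 / Mharm j ^ 2 * y⁻¹) =
      (y * Mharm j - 1) ^ 2 / (Mharm j ^ 2 * y) := by
    field_simp
    ring
  have : 0 ≤ (y * Mharm j - 1) ^ 2 / (Mharm j ^ 2 * y) := by positivity
  linarith

lemma le_integral_mul_sq (h : IsHawkinsSieve μ α) (hF : DependsBelow j F)
    (hF0 : ∀ A : Set ℕ, (∀ n ∈ A, 2 ≤ n) → 0 ≤ F A) {c : ℝ} (hc : 0 < c) :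
    3 / c ^ 2 * ∫ ω, F (α ω) ∂μ - 2 / c ^ 3 * ∫ ω, F (α ω) * (hawkinsY (α ω) j)⁻¹ ∂μ ≤
      ∫ ω, F (α ω) * hawkinsY (α ω) j ^ 2 ∂μ := by
  have hY := DependsBelow.weight j
  have i1 := (h.integrable hF).const_mul (3 / c ^ 2)
  have i2 := (h.integrable (hF.mul hY.inv)).const_mul (2 / c ^ 3)
  rw [← integral_const_mul, ← integral_const_mul, ← integral_sub i1 i2]
  refine MeasureTheory.integral_mono (i1.sub i2) (h.integrable (hF.mul (hY.pow 2))) fun ω => ?_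
  have hpos := hawkinsY_pos (h.mem_ge_two ω) j
  have hF := hF0 _ (h.mem_ge_two ω)
  simp only
  generalize hawkinsY (α ω) j = y at hpos
  have e : F (α ω) * y ^ 2 - (3 / c ^ 2 * F (α ω) - 2 / c ^ 3 * (F (α ω) * y⁻¹)) =
      F (α ω) * ((y * c - 1) ^ 2 * (y * c + 2) / (c ^ 3 * y)) := by
    field_simp
    ring
  have : 0 ≤ F (α ω) * ((y * c - 1) ^ 2 * (y * c + 2) / (c ^ 3 * y)) := by positivity
  linarith

lemma integral_twinWeight (h : IsHawkinsSieve μ α) (hm : 2 ≤ m) :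
    ∫ ω, twinWeight m (α ω) ∂μ = (1 - 1 / (m : ℝ)) * ∫ ω, hawkinsY (α ω) m ∂μ := by
  simpa using h.integral_mul_twinWeight hm (DependsBelow.const m 1)

end IsHawkinsSieve

namespace IsHawkinsSieve

variable {Ω : Type*} [MeasurableSpace Ω] {μ : Measure Ω} {α : Ω → Set ℕ} {m n : ℕ}

lemma integral_twinWeight_mul_sq_le_cube (h : IsHawkinsSieve μ α) (hm : 2 ≤ m) (hmn : m ≤ n) :
    ∫ ω, twinWeight m (α ω) * hawkinsY (α ω) n ^ 2 ∂μ ≤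
      (1 - 1 / (m : ℝ)) * ∫ ω, hawkinsY (α ω) m ^ 3 ∂μ := by
  have hT := DependsBelow.twinWeight m
  have key := h.integral_mul_twinWeight hm ((DependsBelow.weight m).pow 2)
  simp only [← pow_succ] at key
  rw [← key]
  refine h.integral_mono (m := max (m + 3) n) ((hT.mono (le_max_left _ _)).mul
    (((DependsBelow.weight n).pow 2).mono (le_max_right _ _)))
    ((((DependsBelow.weight m).pow 2).mono (by omega)).mul (hT.mono (le_max_left _ _)))
    fun A hA => ?_
  rw [mul_comm]
  exact mul_le_mul_of_nonneg_right
    (pow_le_pow_left₀ (hawkinsY_pos hA n).le (hawkinsY_antitone hA hmn) 2) (twinWeight_nonneg hA m)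

lemma integral_twinWeight_mul_sq_le_one (h : IsHawkinsSieve μ α) (hm : 2 ≤ m) (hmn : m ≤ n) :
    ∫ ω, twinWeight m (α ω) * hawkinsY (α ω) n ^ 2 ∂μ ≤ 1 := by
  have := h.isProb
  refine (h.integral_twinWeight_mul_sq_le_cube hm hmn).trans ?_
  have h1 : ∫ ω, hawkinsY (α ω) m ^ 3 ∂μ ≤ 1 := by
    have := h.integral_mono ((DependsBelow.weight m).pow 3) (DependsBelow.const m 1)
      fun A hA => pow_le_one₀ (hawkinsY_pos hA m).le (hawkinsY_le_one hA m)
    simpa using this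
  have h0 : 0 ≤ ∫ ω, hawkinsY (α ω) m ^ 3 ∂μ :=
    integral_nonneg fun ω => pow_nonneg (hawkinsY_pos (h.mem_ge_two ω) m).le _
  have : 0 ≤ 1 / (m : ℝ) := by positivity
  nlinarith

lemma integral_twinWeight_mul_sq_le (h : IsHawkinsSieve μ α) (hm : 2 ≤ m)
    (hm5 : 5 ≤ MharmLower (m + 3)) (hmn : m + 3 ≤ n) :
    ∫ ω, twinWeight m (α ω) * hawkinsY (α ω) n ^ 2 ∂μ ≤
      1 / MharmLower m / (MharmLower n - 4) ^ 2 := by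
  have h2 : (2 : ℝ) ≤ m := by exact_mod_cast hm
  have hc : 1 / (m : ℝ) ≤ 1 / 2 := one_div_le_one_div_of_le (by norm_num) h2
  have hc0 : 0 ≤ 1 / (m : ℝ) := by positivity
  have ham := one_le_MharmLower hm
  have hstep : MharmLower (m + 3) ≤ MharmLower m + 2 := by
    have e1 := MharmLower_succ hm
    have e2 := MharmLower_succ (show 2 ≤ m + 1 by omega)
    have e3 := MharmLower_succ (show 2 ≤ m + 2 by omega)
    have b1 := MharmLower_increment_le_sixth hm
    have b2 := MharmLower_increment_le_sixth (show 2 ≤ m + 1 by omega)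
    have b3 := MharmLower_increment_le_sixth (show 2 ≤ m + 2 by omega)
    linarith
  have hw : 1 / Mharm m ≤ ∫ ω, hawkinsY (α ω) m ∂μ := h.inv_Mharm_le_integral hm
  have hw' : ∫ ω, hawkinsY (α ω) m ∂μ ≤ 1 / MharmLower m := by
    simpa using h.integral_pow_le (k := 1) (by norm_num) hm
  have hM := one_le_Mharm m
  have hw0 : 0 ≤ ∫ ω, hawkinsY (α ω) m ∂μ := le_trans (by positivity) hw
  refine (h.integral_mul_pow_le (k := 2) (by norm_num) (by omega) (DependsBelow.twinWeight m)
    (fun A hA => twinWeight_nonneg hA m) (s := 4) (by linarith) ?_ hmn).trans ?_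
  · refine (h.integral_twinWeight_mul_sq_le_cube hm (by omega)).trans ?_
    rw [h.integral_twinWeight hm, mul_div_assoc]
    refine mul_le_mul_of_nonneg_left ?_ (by linarith)
    refine (h.integral_pow_le (k := 3) (by norm_num) hm).trans ?_
    refine le_trans ?_ (div_le_div_of_nonneg_right hw (sq_nonneg _))
    rw [div_div]
    refine one_div_le_one_div_of_le ?_ ?_
    · have : 0 < MharmLower (m + 3) - 4 := by linarith
      positivity
    have hM2 : Mharm m ≤ MharmLower m + 2 := by linarith [Mharm_sub_two_le hm]
    have hsq : (MharmLower (m + 3) - 4) ^ 2 ≤ (MharmLower m - 2) ^ 2 :=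
      pow_le_pow_left₀ (by linarith) (by linarith) 2
    calc Mharm m * (MharmLower (m + 3) - 4) ^ 2
        ≤ (MharmLower m + 2) * (MharmLower m - 2) ^ 2 := by gcongr
      _ ≤ MharmLower m ^ 3 := by
        have : 3 ≤ MharmLower m := by linarith
        nlinarith
  · refine div_le_div_of_nonneg_right ?_ (sq_nonneg _)
    rw [h.integral_twinWeight hm]
    exact (mul_le_of_le_one_left hw0 (by linarith)).trans hw'

lemma integral_twinWeight_mul_inv_le (h : IsHawkinsSieve μ α) (hm : 2 ≤ m) :
    ∫ ω, twinWeight m (α ω) * (hawkinsY (α ω) (m + 3))⁻¹ ∂μ ≤ 1 + 2 / (m : ℝ) := by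
  have := h.isProb
  have h2 : (2 : ℝ) ≤ m := by exact_mod_cast hm
  have hm1 : 0 < (m : ℝ) - 1 := by linarith
  have hT := DependsBelow.twinWeight m
  have hY := (DependsBelow.weight m).inv
  have key := h.integral_mul_twinWeight hm hY
  have hc : ∀ ω, (hawkinsY (α ω) m)⁻¹ * hawkinsY (α ω) m = 1 := fun ω =>
    inv_mul_cancel₀ (hawkinsY_pos (h.mem_ge_two ω) m).ne'
  simp only [hc, integral_const, probReal_univ, smul_eq_mul, mul_one] at key
  have hle : ∀ A : Set ℕ, (∀ n ∈ A, 2 ≤ n) →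
      twinWeight m A * (hawkinsY A (m + 3))⁻¹ ≤
        ((m : ℝ) + 2) / (m - 1) * ((hawkinsY A m)⁻¹ * twinWeight m A) := fun A hA => by
    have s1 := inv_hawkinsY_succ_le hA hm
    have s2 := inv_hawkinsY_succ_le hA (show 2 ≤ m + 1 by omega)
    have s3 := inv_hawkinsY_succ_le hA (show 2 ≤ m + 2 by omega)
    push_cast at s2 s3
    have p2 : 0 ≤ ((m : ℝ) + 1) / (m + 1 - 1) := div_nonneg (by linarith) (by linarith)
    have p3 : 0 ≤ ((m : ℝ) + 2) / (m + 2 - 1) := div_nonneg (by linarith) (by linarith)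
    have s : (hawkinsY A (m + 3))⁻¹ ≤ ((m : ℝ) + 2) / (m - 1) * (hawkinsY A m)⁻¹ := by
      refine (s3.trans (mul_le_mul_of_nonneg_left
        (s2.trans (mul_le_mul_of_nonneg_left s1 p2)) p3)).trans_eq ?_
      have e1 : (m : ℝ) + 1 - 1 = m := by ring
      have e2 : (m : ℝ) + 2 - 1 = m + 1 := by ring
      have hm0 : (m : ℝ) ≠ 0 := by linarith
      rw [e1, e2]
      field_simp
    have := mul_le_mul_of_nonneg_left s (twinWeight_nonneg hA m)
    linarith
  calc _ ≤ ∫ ω, ((m : ℝ) + 2) / (m - 1) * ((hawkinsY (α ω) m)⁻¹ * twinWeight m (α ω)) ∂μ :=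
        h.integral_mono (m := m + 3) (hT.mul (DependsBelow.weight _).inv)
          ((DependsBelow.const _ _).mul ((hY.mono (by omega)).mul hT)) hle
    _ = 1 + 2 / (m : ℝ) := by
      rw [integral_const_mul, key]
      have hm0 : (m : ℝ) ≠ 0 := by linarith
      field_simp

lemma le_integral_twinWeight_mul_sq (h : IsHawkinsSieve μ α) (hm : 2 ≤ m) (hmn : m + 3 ≤ n) :
    (1 - 7 * (1 / (m : ℝ))) / Mharm n ^ 3 ≤
      ∫ ω, twinWeight m (α ω) * hawkinsY (α ω) n ^ 2 ∂μ := by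
  have h2 : (2 : ℝ) ≤ m := by exact_mod_cast hm
  have hc : 1 / (m : ℝ) ≤ 1 / 2 := one_div_le_one_div_of_le (by norm_num) h2
  have hc0 : 0 ≤ 1 / (m : ℝ) := by positivity
  have hT := DependsBelow.twinWeight m
  have hM : 0 < Mharm n := zero_lt_one.trans_le (one_le_Mharm n)
  have hMm : 0 < Mharm m := zero_lt_one.trans_le (one_le_Mharm m)
  have hmono : Mharm m ≤ Mharm (m + 3) := Mharm_mono (by omega)
  have hmono' : Mharm (m + 3) ≤ Mharm n := Mharm_mono hmn
  refine le_trans ?_ (h.le_integral_mul_sq (hT.mono hmn) (fun A hA => twinWeight_nonneg hA m) hM)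
  rw [h.integral_mul_inv (by omega) hT hmn]
  have hI := h.integral_twinWeight_mul_inv_le hm
  have hw : (1 - 1 / (m : ℝ)) * (1 / Mharm m) ≤ ∫ ω, twinWeight m (α ω) ∂μ := by
    rw [h.integral_twinWeight hm]
    exact mul_le_mul_of_nonneg_left (h.inv_Mharm_le_integral hm) (by linarith)
  generalize ∫ ω, twinWeight m (α ω) ∂μ = w at hw
  generalize ∫ ω, twinWeight m (α ω) * (hawkinsY (α ω) (m + 3))⁻¹ ∂μ = I at hI
  have hw' : 1 - 1 / (m : ℝ) ≤ w * Mharm m := by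
    rwa [mul_one_div, div_le_iff₀ hMm] at hw
  have hw0 : 0 ≤ w := le_trans (mul_nonneg (by linarith) (by positivity)) hw
  have hw1 : w * Mharm m ≤ w * Mharm (m + 3) := mul_le_mul_of_nonneg_left hmono hw0
  have hw2 : w * Mharm (m + 3) ≤ w * Mharm n := mul_le_mul_of_nonneg_left hmono' hw0
  have e : 3 / Mharm n ^ 2 * w - 2 / Mharm n ^ 3 * (I + (Mharm n - Mharm (m + 3)) * w) =
      (3 * (w * Mharm n) - 2 * (I + (Mharm n - Mharm (m + 3)) * w)) / Mharm n ^ 3 := by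
    field_simp
  rw [e]
  refine div_le_div_of_nonneg_right ?_ (by positivity)
  have e' : 2 / (m : ℝ) = 2 * (1 / m) := by ring
  rw [e'] at hI
  linarith

lemma integral_sq_mul_piHat (h : IsHawkinsSieve μ α) (n : ℕ) :
    ∫ ω, hawkinsY (α ω) (n + 1) ^ 2 * piHat (α ω) n ∂μ =
      ∑ m ∈ Finset.Icc 2 n, ∫ ω, twinWeight m (α ω) * hawkinsY (α ω) (n + 1) ^ 2 ∂μ := by
  rw [← integral_finsetSum]
  · refine integral_congr_ae (ae_of_all _ fun ω => ?_)
    simp only [piHat_eq_sum_Icc (h.mem_ge_two ω), Finset.mul_sum, mul_comm]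
  · intro m hm
    have := (Finset.mem_Icc.1 hm).2
    exact h.integrable (m := n + 3) (((DependsBelow.twinWeight m).mono (by omega)).mul
      (((DependsBelow.weight (n + 1)).pow 2).mono (by omega)))

end IsHawkinsSieve

lemma Mharm_eq_harmonic (n : ℕ) : Mharm (n + 2) = 1 + harmonic n := by
  rw [harmonic_eq_sum_Icc]
  simp [Mharm]

lemma tendsto_Mharm_atTop : Tendsto Mharm atTop atTop := by
  rw [← tendsto_add_atTop_iff_nat 2]
  refine tendsto_atTop_mono (f := fun n : ℕ => Real.log ((n + 1 : ℕ) : ℝ)) (fun n => ?_) ?_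
  · rw [Mharm_eq_harmonic]
    linarith [log_add_one_le_harmonic n]
  · exact Real.tendsto_log_atTop.comp (tendsto_natCast_atTop_atTop.comp (tendsto_add_atTop_nat 1))

lemma eventually_Mharm_pow_four_le : ∀ᶠ n : ℕ in atTop, Mharm n ^ 4 ≤ n := by
  have hlog : ∀ᶠ n : ℕ in atTop, Real.log n ^ 4 ≤ 1 / 16 * (n : ℝ) := by
    have := ((Real.isLittleO_pow_log_id_atTop (n := 4)).comp_tendsto
      tendsto_natCast_atTop_atTop).bound (show (0 : ℝ) < 1 / 16 by norm_num)
    filter_upwards [this] with n hn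
    simpa using (le_abs_self _).trans hn
  have hlog2 : ∀ᶠ n : ℕ in atTop, 2 ≤ Real.log (n : ℝ) :=
    (Real.tendsto_log_atTop.comp tendsto_natCast_atTop_atTop).eventually_ge_atTop 2
  filter_upwards [hlog, hlog2, eventually_ge_atTop 3] with n h1 h2 h3
  obtain ⟨i, rfl⟩ := Nat.exists_eq_add_of_le' (show 2 ≤ n by omega)
  have hle : Mharm (i + 2) ≤ 2 * Real.log ((i + 2 : ℕ) : ℝ) := by
    have hi := harmonic_le_one_add_log i
    have : Real.log i ≤ Real.log ((i + 2 : ℕ) : ℝ) :=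
      Real.log_le_log (by exact_mod_cast (by omega : 0 < i)) (by exact_mod_cast (by omega))
    rw [Mharm_eq_harmonic]
    linarith
  have := pow_le_pow_left₀ (zero_le_one.trans (one_le_Mharm _)) hle 4
  rw [mul_pow] at this
  linarith

lemma sum_inv_MharmLower_le {n : ℕ} (hn : 2 ≤ n) :
    ∑ m ∈ Finset.Ico 2 n, 1 / MharmLower m ≤
      n / MharmLower n + ∑ m ∈ Finset.Ico 2 n, 1 / MharmLower m ^ 2 := by
  induction n, hn using Nat.le_induction with
  | base => simp [MharmLower_two]
  | succ n hn ih =>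
    have h2 : (2 : ℝ) ≤ n := by exact_mod_cast hn
    have ha := one_le_MharmLower hn
    have hδ := MharmLower_increment_nonneg hn
    rw [Finset.sum_Ico_succ_top hn, Finset.sum_Ico_succ_top hn, MharmLower_succ hn]
    have hmul : ((n : ℝ) + 1) * (((n : ℝ) - 2) / (n * (n - 1))) ≤ 1 := by
      rw [← mul_div_assoc, div_le_one (mul_pos (by linarith) (by linarith))]
      nlinarith
    generalize ((n : ℝ) - 2) / (n * (n - 1)) = δ at hδ hmul
    generalize MharmLower n = a at *
    push_cast
    have key : ((n : ℝ) + 1) / a ≤ (n + 1) / (a + δ) + 1 / a ^ 2 := by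
      have e : ((n : ℝ) + 1) / (a + δ) + 1 / a ^ 2 - (n + 1) / a =
          ((a + δ) - (n + 1) * δ * a) / (a ^ 2 * (a + δ)) := by
        have : a + δ ≠ 0 := by linarith
        field_simp
        ring
      have : 0 ≤ ((a + δ) - (n + 1) * δ * a) / (a ^ 2 * (a + δ)) := by
        refine div_nonneg ?_ (by positivity)
        nlinarith
      linarith
    have e : ((n : ℝ) + 1) / a = n / a + 1 / a := by ring
    linarith

lemma exists_sum_inv_MharmLower_sq_le :
    ∃ K : ℝ, 0 ≤ K ∧ ∀ n ≥ 2, ∑ m ∈ Finset.Ico 2 n, 1 / MharmLower m ^ 2 ≤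
      K + 2 * n / MharmLower n ^ 2 := by
  obtain ⟨N, hN⟩ := eventually_atTop.1 (tendsto_Mharm_atTop.eventually_ge_atTop 6)
  refine ⟨N, Nat.cast_nonneg N, fun n hn => ?_⟩
  induction n, hn using Nat.le_induction with
  | base => simp [MharmLower_two]; positivity
  | succ n hn ih =>
    have hn' : 2 ≤ n + 1 := by omega
    rcases Nat.lt_or_ge n N with hlt | hge
    · have hsum : ∑ m ∈ Finset.Ico 2 (n + 1), 1 / MharmLower m ^ 2 ≤
          ∑ m ∈ Finset.Ico 2 (n + 1), 1 := Finset.sum_le_sum fun m hm => by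
        have := one_le_MharmLower (Finset.mem_Ico.1 hm).1
        exact div_le_one_of_le₀ (one_le_pow₀ this) (by positivity)
      have hcard : (∑ m ∈ Finset.Ico 2 (n + 1), 1 : ℝ) ≤ N := by
        simp only [Finset.sum_const, Nat.card_Ico, nsmul_eq_mul, mul_one]
        exact_mod_cast (by omega)
      have : 0 ≤ 2 * ((n + 1 : ℕ) : ℝ) / MharmLower (n + 1) ^ 2 := by positivity
      linarith
    · have h2 : (2 : ℝ) ≤ n := by exact_mod_cast hn
      have ha : 4 ≤ MharmLower n := by linarith [hN n hge, Mharm_sub_two_le hn]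
      have hδ := MharmLower_increment_nonneg hn
      rw [Finset.sum_Ico_succ_top hn, MharmLower_succ hn]
      have hmul : ((n : ℝ) + 1) * (((n : ℝ) - 2) / (n * (n - 1))) ≤ 1 := by
        rw [← mul_div_assoc, div_le_one (mul_pos (by linarith) (by linarith))]
        nlinarith
      have hδ1 := MharmLower_increment_le_sixth hn
      generalize ((n : ℝ) - 2) / (n * (n - 1)) = δ at hδ hmul hδ1
      generalize MharmLower n = a at *
      push_cast
      have key : (2 * (n : ℝ) + 1) / a ^ 2 ≤ 2 * (n + 1) / (a + δ) ^ 2 := by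
        rw [div_le_div_iff₀ (by positivity) (by positivity)]
        have hsq : (n + 1) * δ * δ ≤ 1 * 1 := mul_le_mul hmul (by linarith) hδ (by norm_num)
        nlinarith
      have e : (2 * (n : ℝ) + 1) / a ^ 2 = 2 * n / a ^ 2 + 1 / a ^ 2 := by ring
      linarith

lemma IsHawkinsSieve.le_sum_integral {Ω : Type*} [MeasurableSpace Ω] {μ : Measure Ω}
    {α : Ω → Set ℕ} (h : IsHawkinsSieve μ α) {n : ℕ} (hn : 4 ≤ n) :
    (n : ℝ) / Mharm n ^ 3 - 16 ≤
      ∑ m ∈ Finset.Icc 2 n, ∫ ω, twinWeight m (α ω) * hawkinsY (α ω) (n + 1) ^ 2 ∂μ := by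
  have hn4 : (4 : ℝ) ≤ n := by exact_mod_cast hn
  have hM := one_le_Mharm n
  have hM' := one_le_Mharm (n + 1)
  have hsub : Finset.Icc 2 (n - 2) ⊆ Finset.Icc 2 n :=
    Finset.Icc_subset_Icc_right (Nat.sub_le _ _)
  have hinv : ∑ m ∈ Finset.Icc 2 (n - 2), 1 / (m : ℝ) ≤ Mharm (n + 1) := by
    have : ∑ m ∈ Finset.Icc 2 (n - 2), 1 / (m : ℝ) ≤ ∑ m ∈ Finset.Icc 1 (n - 2), 1 / (m : ℝ) :=
      Finset.sum_le_sum_of_subset_of_nonneg (Finset.Icc_subset_Icc_left (by norm_num))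
        fun _ _ _ => by positivity
    have hmono : Mharm n ≤ Mharm (n + 1) := Mharm_mono n.le_succ
    have hdef : Mharm n = 1 + ∑ m ∈ Finset.Icc 1 (n - 2), 1 / (m : ℝ) := rfl
    linarith
  have hcard : ((Finset.Icc 2 (n - 2)).card : ℝ) = n - 3 := by
    rw [Nat.card_Icc, show n - 2 + 1 - 2 = n - 3 by omega, Nat.cast_sub (by omega)]
    norm_num
  have hlow : ((n : ℝ) - 3 - 7 * Mharm (n + 1)) / Mharm (n + 1) ^ 3 ≤
      ∑ m ∈ Finset.Icc 2 n, ∫ ω, twinWeight m (α ω) * hawkinsY (α ω) (n + 1) ^ 2 ∂μ := by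
    calc ((n : ℝ) - 3 - 7 * Mharm (n + 1)) / Mharm (n + 1) ^ 3
        ≤ (∑ m ∈ Finset.Icc 2 (n - 2), (1 - 7 * (1 / (m : ℝ)))) / Mharm (n + 1) ^ 3 := by
          gcongr
          rw [Finset.sum_sub_distrib, ← Finset.mul_sum, Finset.sum_const, nsmul_eq_mul, hcard]
          linarith
      _ = ∑ m ∈ Finset.Icc 2 (n - 2), (1 - 7 * (1 / (m : ℝ))) / Mharm (n + 1) ^ 3 :=
          Finset.sum_div _ _ _
      _ ≤ ∑ m ∈ Finset.Icc 2 (n - 2),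
            ∫ ω, twinWeight m (α ω) * hawkinsY (α ω) (n + 1) ^ 2 ∂μ :=
          Finset.sum_le_sum fun m hm => by
            have := Finset.mem_Icc.1 hm
            exact h.le_integral_twinWeight_mul_sq this.1 (by omega)
      _ ≤ _ := Finset.sum_le_sum_of_subset_of_nonneg hsub fun m _ _ =>
          integral_nonneg fun ω => mul_nonneg (twinWeight_nonneg (h.mem_ge_two ω) m) (sq_nonneg _)
  refine le_trans ?_ hlow
  have hsucc := Mharm_succ (show 2 ≤ n by omega)
  have hd : 0 ≤ 1 / ((n : ℝ) - 1) := div_nonneg zero_le_one (by linarith)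
  have hnd : (n : ℝ) * (1 / ((n : ℝ) - 1)) ≤ 2 := by
    rw [mul_one_div, div_le_iff₀ (by linarith)]
    linarith
  generalize 1 / ((n : ℝ) - 1) = d at *
  generalize Mharm (n + 1) = b at *
  generalize Mharm n = a at *
  have hab : a ≤ b := by linarith
  have e1 : ((n : ℝ) - 3 - 7 * b) / b ^ 3 = n / b ^ 3 - 3 / b ^ 3 - 7 / b ^ 2 := by
    field_simp
  have e2 : (n : ℝ) / a ^ 3 - n / b ^ 3 =
      n * (b - a) * (a ^ 2 + a * b + b ^ 2) / (a ^ 3 * b ^ 3) := by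
    field_simp
    ring
  have e3 : n * (b - a) * (a ^ 2 + a * b + b ^ 2) / (a ^ 3 * b ^ 3) ≤ 6 := by
    rw [div_le_iff₀ (by positivity)]
    have : (n : ℝ) * (b - a) ≤ 2 := by rwa [hsucc, add_sub_cancel_left]
    have hq : a ^ 2 + a * b + b ^ 2 ≤ 3 * b ^ 2 := by nlinarith
    have hq' : b ^ 2 ≤ a ^ 3 * b ^ 3 := by
      have : 1 * b ^ 2 ≤ a ^ 3 * b ^ 3 :=
        mul_le_mul (one_le_pow₀ hM) (pow_le_pow_right₀ hM' (by norm_num)) (by positivity)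
          (by positivity)
      linarith
    calc _ ≤ 2 * (3 * b ^ 2) := mul_le_mul this hq (by positivity) (by norm_num)
      _ ≤ _ := by linarith
  have e4 : 3 / b ^ 3 ≤ 3 := div_le_self (by norm_num) (one_le_pow₀ hM')
  have e5 : 7 / b ^ 2 ≤ 7 := div_le_self (by norm_num) (one_le_pow₀ hM')
  linarith

lemma IsHawkinsSieve.exists_sum_integral_le {Ω : Type*} [MeasurableSpace Ω] {μ : Measure Ω}
    {α : Ω → Set ℕ} (h : IsHawkinsSieve μ α) :
    ∃ C : ℝ, 0 ≤ C ∧ ∀ᶠ n : ℕ in atTop,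
      ∑ m ∈ Finset.Icc 2 n, ∫ ω, twinWeight m (α ω) * hawkinsY (α ω) (n + 1) ^ 2 ∂μ ≤
        (n : ℝ) / Mharm n ^ 3 + 84 * (n / Mharm n ^ 4) + C := by
  obtain ⟨K, hK, hsq⟩ := exists_sum_inv_MharmLower_sq_le
  obtain ⟨N, hN⟩ := eventually_atTop.1 (tendsto_Mharm_atTop.eventually_ge_atTop 7)
  refine ⟨K + (N + 2) + 1, by positivity, ?_⟩
  filter_upwards [tendsto_Mharm_atTop.eventually_ge_atTop 12, eventually_ge_atTop 2] with n hM hn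
  have hterm : ∀ m ∈ Finset.Icc 2 n,
      ∫ ω, twinWeight m (α ω) * hawkinsY (α ω) (n + 1) ^ 2 ∂μ ≤
        1 / MharmLower m / (MharmLower (n + 1) - 4) ^ 2 +
          if m < N ∨ n < m + 2 then 1 else 0 := fun m hm => by
    obtain ⟨hm2, hmn⟩ := Finset.mem_Icc.1 hm
    have ham := one_le_MharmLower hm2
    split_ifs with hsmall
    · have := h.integral_twinWeight_mul_sq_le_one hm2 (hmn.trans n.le_succ)
      have : 0 ≤ 1 / MharmLower m / (MharmLower (n + 1) - 4) ^ 2 := by positivity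
      linarith
    · push Not at hsmall
      have h7 := hN (m + 3) (by omega)
      rw [add_zero]
      exact h.integral_twinWeight_mul_sq_le hm2
        (by linarith [Mharm_sub_two_le (show 2 ≤ m + 3 by omega)]) (by omega)
  have hcard : ∑ m ∈ Finset.Icc 2 n, (if m < N ∨ n < m + 2 then (1 : ℝ) else 0) ≤ N + 2 := by
    rw [Finset.sum_boole]
    have hsub : (Finset.Icc 2 n).filter (fun m => m < N ∨ n < m + 2) ⊆
        Finset.range N ∪ {n - 1, n} := fun m hm => by
      simp only [Finset.mem_filter, Finset.mem_Icc, Finset.mem_union, Finset.mem_range,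
        Finset.mem_insert, Finset.mem_singleton] at *
      omega
    have := (Finset.card_le_card hsub).trans (Finset.card_union_le _ _)
    have h2 : ({n - 1, n} : Finset ℕ).card ≤ 2 := Finset.card_le_two
    rw [Finset.card_range] at this
    exact_mod_cast this.trans (Nat.add_le_add_left h2 N)
  refine (Finset.sum_le_sum hterm).trans ?_
  rw [Finset.sum_add_distrib, ← Finset.sum_div]
  have hIcc : Finset.Icc 2 n = Finset.Ico 2 (n + 1) := by
    ext
    simp only [Finset.mem_Icc, Finset.mem_Ico]
    omega
  have hS1 := sum_inv_MharmLower_le (show 2 ≤ n + 1 by omega)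
  have hS2 := hsq (n + 1) (by omega)
  have ha : Mharm n - 2 ≤ MharmLower (n + 1) := by
    have hmono : Mharm n ≤ Mharm (n + 1) := Mharm_mono n.le_succ
    linarith [Mharm_sub_two_le (show 2 ≤ n + 1 by omega)]
  rw [← hIcc] at hS1 hS2
  generalize Mharm n = M at *
  generalize MharmLower (n + 1) = a at *
  push_cast at hS1 hS2
  have hn0 : (0 : ℝ) ≤ n := Nat.cast_nonneg n
  have hM6 : 6 ≤ M - 6 := by linarith
  have hsum : ∑ m ∈ Finset.Icc 2 n, 1 / MharmLower m ≤ (n + 1) / (M - 6) + K := by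
    have h1 : ((n : ℝ) + 1) / a + 2 * (n + 1) / a ^ 2 ≤ (n + 1) / (a - 4) := by
      have ha4 : 0 < a - 4 := by linarith
      have ha0 : 0 < a := by linarith
      have e : ((n : ℝ) + 1) / (a - 4) - (((n : ℝ) + 1) / a + 2 * (n + 1) / a ^ 2) =
          (n + 1) * (2 * a + 8) / (a ^ 2 * (a - 4)) := by
        field_simp
        ring
      have : 0 ≤ ((n : ℝ) + 1) * (2 * a + 8) / (a ^ 2 * (a - 4)) := by positivity
      linarith
    have h2 : ((n : ℝ) + 1) / (a - 4) ≤ (n + 1) / (M - 6) :=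
      div_le_div_of_nonneg_left (by positivity) (by linarith) (by linarith)
    linarith
  have hmain : (∑ m ∈ Finset.Icc 2 n, 1 / MharmLower m) / (a - 4) ^ 2 ≤
      (n + 1) / (M - 6) ^ 3 + K := by
    have hM6' : 0 < M - 6 := by linarith
    calc _ ≤ ((n + 1) / (M - 6) + K) / (a - 4) ^ 2 := by gcongr
      _ ≤ ((n + 1) / (M - 6) + K) / (M - 6) ^ 2 :=
        div_le_div_of_nonneg_left (by positivity) (by positivity)
          (pow_le_pow_left₀ hM6'.le (by linarith) 2)
      _ = (n + 1) / (M - 6) ^ 3 + K / (M - 6) ^ 2 := by field_simp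
      _ ≤ _ := by
        gcongr
        exact div_le_self hK (one_le_pow₀ (by linarith))
  have hexp : 1 / (M - 6) ^ 3 ≤ 1 / M ^ 3 + 84 / M ^ 4 := by
    have hM0 : 0 < M := by linarith
    have e : 1 / M ^ 3 + 84 / M ^ 4 = (M + 84) / M ^ 4 := by field_simp
    have hM6' : 0 < M - 6 := by linarith
    rw [e, div_le_div_iff₀ (by positivity) (by positivity)]
    obtain ⟨t, rfl⟩ : ∃ t, M = t + 12 := ⟨M - 12, by ring⟩
    have ht : 0 ≤ t := by linarith
    have := pow_nonneg ht 2
    have := pow_nonneg ht 3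
    nlinarith
  have hone : 1 / M ^ 3 + 84 / M ^ 4 ≤ 1 := by
    have h3 : 1 / M ^ 3 ≤ 1 / 12 ^ 3 := by gcongr
    have h4 : 84 / M ^ 4 ≤ 84 / 12 ^ 4 := by gcongr
    have : (1 : ℝ) / 12 ^ 3 + 84 / 12 ^ 4 ≤ 1 := by norm_num
    linarith
  have hfin : ((n : ℝ) + 1) / (M - 6) ^ 3 ≤ n / M ^ 3 + 84 * (n / M ^ 4) + 1 := by
    calc ((n : ℝ) + 1) / (M - 6) ^ 3 = (n + 1) * (1 / (M - 6) ^ 3) := by ring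
      _ ≤ (n + 1) * (1 / M ^ 3 + 84 / M ^ 4) := by gcongr
      _ = n / M ^ 3 + 84 * (n / M ^ 4) + (1 / M ^ 3 + 84 / M ^ 4) := by ring
      _ ≤ _ := by linarith
  linarith

theorem piHat_weighted_second_moment {Ω : Type*} [MeasurableSpace Ω] (μ : Measure Ω)
    (α : Ω → Set ℕ) (h : IsHawkinsSieve μ α) :
    (fun n : ℕ =>
        (∫ ω, (hawkinsY (α ω) (n + 1)) ^ 2 * piHat (α ω) n ∂μ) - (n : ℝ) / (Mharm n) ^ 3)
      =O[atTop] fun n : ℕ => (n : ℝ) / (Mharm n) ^ 4 := by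
  obtain ⟨C, hC, hupper⟩ := h.exists_sum_integral_le
  refine IsBigO.of_bound (84 + C + 16) ?_
  filter_upwards [hupper, eventually_Mharm_pow_four_le, eventually_ge_atTop 4] with n hup hpow hn
  have hlow := h.le_sum_integral hn
  have hM := one_le_Mharm n
  have hone : 1 ≤ (n : ℝ) / Mharm n ^ 4 := (one_le_div (by positivity)).2 hpow
  rw [h.integral_sq_mul_piHat, Real.norm_eq_abs, Real.norm_of_nonneg (by linarith), abs_le]
  constructor <;> nlinarith
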